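/- arXiv:math/0610716 — 5 statements merged into one kernel-verified Lean document; each statement's English description precedes it below -/
import Mathlib

section
/- Let P be a nonempty subset of ℝ² × [0,∞), let z = (w,t) ∈ P, and let V_z = {x ∈ ℝ² : d_JM((x,0), z) ≤ d_JM((x,0), z') for all z' ∈ P}. Then V_z is star-shaped with centre w: for every x ∈ V_z and every point y on the line segment from w to x, one has y ∈ V_z. In particular, V_z is a connected subset of ℝ². -/
/-- The Johnson–Mehl norm of a point `(x, t) ∈ ℝ² × ℝ`: `‖x‖₂ + |t|`. -/
noncomputable def jmNorm (v : (EuclideanSpace ℝ (Fin 2)) × ℝ) : ℝ := ‖v.1‖ + |v.2|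

/-- The Johnson–Mehl distance on `ℝ² × ℝ`. -/
noncomputable def jmDist (v w : (EuclideanSpace ℝ (Fin 2)) × ℝ) : ℝ := jmNorm (v - w)

/-- The Johnson–Mehl cell of `z = (w, t)` relative to the set `P`. -/
def jmCell (P : Set ((EuclideanSpace ℝ (Fin 2)) × ℝ)) (z : (EuclideanSpace ℝ (Fin 2)) × ℝ) :
    Set (EuclideanSpace ℝ (Fin 2)) :=
  {x | ∀ z' ∈ P, jmDist (x, 0) z ≤ jmDist (x, 0) z'}

/-- A Johnson–Mehl cell is star-shaped about the spatial coordinate of its centre. -/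
theorem starConvex_jmCell (P : Set ((EuclideanSpace ℝ (Fin 2)) × ℝ))
    (z : (EuclideanSpace ℝ (Fin 2)) × ℝ) : StarConvex ℝ z.1 (jmCell P z) := by
  intro x hx a b ha hb hab z' hz'
  have hle := hx z' hz'
  simp only [jmDist, jmNorm, Prod.fst_sub, Prod.snd_sub] at hle ⊢
  obtain rfl : a = 1 - b := by linarith
  have hyw : ‖(1 - b) • z.1 + b • x - z.1‖ = b * ‖x - z.1‖ := by
    rw [← norm_smul_of_nonneg hb]
    congr 1
    module
  have hxy : ‖x - ((1 - b) • z.1 + b • x)‖ = (1 - b) * ‖x - z.1‖ := by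
    rw [← norm_smul_of_nonneg ha]
    congr 1
    module
  have htri := norm_sub_le_norm_sub_add_norm_sub x ((1 - b) • z.1 + b • x) z'.1
  linarith

theorem stmt0 (P : Set ((EuclideanSpace ℝ (Fin 2)) × ℝ)) (hP : P.Nonempty)
    (hPpos : ∀ z ∈ P, 0 ≤ z.2)
    (w : EuclideanSpace ℝ (Fin 2)) (t : ℝ) (hz : (w, t) ∈ P) :
    StarConvex ℝ w (jmCell P (w, t)) ∧ IsPreconnected (jmCell P (w, t)) := by
  have hstar : StarConvex ℝ w (jmCell P (w, t)) := starConvex_jmCell P (w, t)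
  refine ⟨hstar, ?_⟩
  rcases (jmCell P (w, t)).eq_empty_or_nonempty with hempty | hne
  · rw [hempty]
    exact isPreconnected_empty
  · exact (StarConvex.isPathConnected hstar (hstar.mem hne)).isConnected.isPreconnected
end

section
/- Let ρ be any norm on ℝ² and σ any metric on ℝ, and define a metric d on ℝ² × ℝ by d((x,s),(y,t)) = ρ(x − y) + σ(s,t). Let P be a nonempty subset of ℝ² × [0,∞), let z = (w,t) ∈ P, and let V_z = {x ∈ ℝ² : d((x,0), z) ≤ d((x,0), z') for all z' ∈ P}. Then V_z is star-shaped with centre w: for every x ∈ V_z, the line segment from w to x is contained in V_z. -/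
theorem stmt1
    -- ρ is a norm on ℝ²
    (ρ : EuclideanSpace ℝ (Fin 2) → ℝ)
    (hρ_triangle : ∀ x y, ρ (x + y) ≤ ρ x + ρ y)
    (hρ_smul : ∀ (c : ℝ) (x), ρ (c • x) = |c| * ρ x)
    (hρ_zero : ∀ x, ρ x = 0 → x = 0)
    -- σ is a metric on ℝ
    (σ : ℝ → ℝ → ℝ)
    (hσ_self : ∀ s t, σ s t = 0 ↔ s = t)
    (hσ_symm : ∀ s t, σ s t = σ t s)
    (hσ_triangle : ∀ s t u, σ s u ≤ σ s t + σ t u)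
    -- the direct-sum metric is d((x,s),(y,t)) = ρ (x - y) + σ s t
    (d : ((EuclideanSpace ℝ (Fin 2)) × ℝ) → ((EuclideanSpace ℝ (Fin 2)) × ℝ) → ℝ)
    (hd : ∀ v v', d v v' = ρ (v.1 - v'.1) + σ v.2 v'.2)
    -- P ⊆ ℝ² × [0,∞) nonempty, z = (w,t) ∈ P
    (P : Set ((EuclideanSpace ℝ (Fin 2)) × ℝ)) (hP : P.Nonempty)
    (hPpos : ∀ z ∈ P, 0 ≤ z.2)
    (w : EuclideanSpace ℝ (Fin 2)) (t : ℝ) (hz : (w, t) ∈ P) :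
    -- the cell V_z is star-shaped with centre w
    StarConvex ℝ w {x : EuclideanSpace ℝ (Fin 2) |
      ∀ z' ∈ P, d (x, 0) (w, t) ≤ d (x, 0) z'} := by
  intro x hx a b ha hb hab z' hz'
  have hxz := hx z' hz'
  simp only [hd] at hxz ⊢
  obtain rfl : a = 1 - b := by linarith
  have hyw : (1 - b) • w + b • x - w = b • (x - w) := by module
  have hxy : x - z'.1 = (1 - b) • (x - w) + ((1 - b) • w + b • x - z'.1) := by module
  have htri := hρ_triangle ((1 - b) • (x - w)) ((1 - b) • w + b • x - z'.1)
  rw [← hxy, hρ_smul, abs_of_nonneg ha] at htri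
  rw [hyw, hρ_smul, abs_of_nonneg hb]
  linarith
end

section
/- Every line segment contained in the unit sphere of the Johnson–Mehl norm makes an angle π/4 with the plane ℝ² × {0}. Precisely: if A = (a,s) and B = (b,u) are points of ℝ² × ℝ with ‖A‖_JM = ‖B‖_JM = 1 and ‖(A + B)/2‖_JM = 1, then |s − u| = ‖a − b‖₂. -/
theorem stmt6 (a b : EuclideanSpace ℝ (Fin 2)) (s u : ℝ)
    (hA : jmNorm (a, s) = 1) (hB : jmNorm (b, u) = 1)
    (hmid : jmNorm ((2⁻¹ : ℝ) • ((a, s) + (b, u))) = 1) :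
    |s - u| = ‖a - b‖ := by
  simp only [jmNorm, Prod.smul_fst, Prod.smul_snd, Prod.fst_add, Prod.snd_add, norm_smul,
    smul_eq_mul, abs_mul] at hA hB hmid
  norm_num at hmid
  have hab := norm_add_le a b
  have hsu := abs_add_le s u
  have ha : SameRay ℝ a b := sameRay_iff_norm_add.2 (by linarith)
  have hs : SameRay ℝ s u := sameRay_iff_norm_add.2 (by simp only [Real.norm_eq_abs]; linarith)
  have hdiff := hs.norm_sub
  simp only [Real.norm_eq_abs] at hdiff
  rw [hdiff, ha.norm_sub, abs_sub_comm]
  congr 1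
  linarith
end

section
/- For every c > 0 and every η ∈ (0,1) there exists ε > 0 with the following property: if A = (a,s) and B = (b,u) are points of ℝ² × ℝ with ‖A‖_JM = ‖B‖_JM = 1, the Euclidean distance from A to B (in ℝ³) is at least c, and either |s − u| ≤ (1 − η)‖a − b‖₂ or |s − u| ≥ (1 + η)‖a − b‖₂ (i.e. the direction of the segment AB makes an angle with the plane bounded away from π/4), then ‖(A + B)/2‖_JM ≤ 1 − ε. -/
/-- Two points with heights of the same sign: the upper bound on the norm of their sum. Here
`r`, `q` are the norms of the horizontal parts, `d` and `m` the norms of the difference and of the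
sum of the horizontal parts. -/
theorem add_le_of_same_sign {c η r q d m : ℝ} (hc : 0 < c) (hη0 : 0 < η) (hη1 : η < 1)
    (hr : r ≤ 1) (hq : q ≤ 1) (hd : 0 ≤ d) (hrq : |r - q| ≤ d)
    (hmrq : m ≤ r + q) (hpar : m ^ 2 + d ^ 2 = 2 * r ^ 2 + 2 * q ^ 2)
    (hcd : c ^ 2 ≤ d ^ 2 + |r - q| ^ 2)
    (h : |r - q| ≤ (1 - η) * d ∨ (1 + η) * d ≤ |r - q|) :
    m + (2 - r - q) ≤ 2 - η * c ^ 2 / 8 := by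
  have hD := abs_nonneg (r - q)
  have hsq : |r - q| ^ 2 = (r - q) ^ 2 := sq_abs _
  have hc2 : 0 < c ^ 2 := by positivity
  have hle : |r - q| ^ 2 ≤ d ^ 2 := by gcongr
  rcases h with h | h
  · have h1 : |r - q| ^ 2 ≤ ((1 - η) * d) ^ 2 := by gcongr
    have h2 : ((1 - η) * d) ^ 2 ≤ (1 - η) * d ^ 2 := by
      nlinarith [mul_nonneg (mul_nonneg hη0.le (sub_nonneg.2 hη1.le)) (sq_nonneg d)]
    have h3 : η * c ^ 2 ≤ η * (2 * d ^ 2) := by gcongr; linarith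
    have h4 : η * c ^ 2 / 2 ≤ (r + q - m) * (r + q + m) := by nlinarith
    have h5 : (r + q - m) * (r + q + m) ≤ (r + q - m) * 4 := by
      apply mul_le_mul_of_nonneg_left <;> linarith
    linarith
  · have : d = 0 := by nlinarith
    subst this
    nlinarith

/-- Two points with heights of opposite signs: the upper bound on the norm of their sum. -/
theorem add_le_of_opposite_sign {c η r q d m : ℝ} (hη0 : 0 < η) (hη1 : η < 1)
    (hr : r ≤ 1) (hq0 : 0 ≤ q) (hqr : q ≤ r) (hd : 0 ≤ d)
    (hmrq : m ≤ r + q) (hpar : m ^ 2 + d ^ 2 = 2 * r ^ 2 + 2 * q ^ 2)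
    (hrq : r - q ≤ d)
    (hcd : c ^ 2 ≤ d ^ 2 + (2 - r - q) ^ 2)
    (h : 2 - r - q ≤ (1 - η) * d ∨ (1 + η) * d ≤ 2 - r - q) :
    m + (r - q) ≤ 2 - η * c ^ 2 / 8 := by
  have hD : 0 ≤ 2 - r - q := by linarith
  rcases h with h | h
  · have h1 : (2 - r - q) ^ 2 ≤ ((1 - η) * d) ^ 2 := by gcongr
    have h2 : ((1 - η) * d) ^ 2 ≤ (1 - η) * d ^ 2 := by
      nlinarith [mul_nonneg (mul_nonneg hη0.le (sub_nonneg.2 hη1.le)) (sq_nonneg d)]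
    have h0 : (1 - η) * d ^ 2 ≤ d ^ 2 := by nlinarith [sq_nonneg d]
    have h3 : η * c ^ 2 ≤ η * (2 * d ^ 2) := by gcongr; linarith
    have h6 : (r - q) ^ 2 ≤ (2 - r - q) ^ 2 := by
      apply pow_le_pow_left₀ <;> linarith
    have h4 : η * c ^ 2 / 2 ≤ (r + q - m) * (r + q + m) := by nlinarith
    have h5 : (r + q - m) * (r + q + m) ≤ (r + q - m) * 4 := by
      apply mul_le_mul_of_nonneg_left <;> linarith
    linarith
  · have h1 : ((1 + η) * d) ^ 2 ≤ (2 - r - q) ^ 2 := by gcongr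
    have h2 : (1 + η) * d ^ 2 ≤ ((1 + η) * d) ^ 2 := by
      nlinarith [mul_nonneg (mul_nonneg hη0.le (by linarith : 0 ≤ 1 + η)) (sq_nonneg d)]
    have h3 : η * c ^ 2 ≤ η * (d ^ 2 + (2 - r - q) ^ 2) := by gcongr
    have h6 : (r - q) ^ 2 ≤ d ^ 2 := by
      apply pow_le_pow_left₀ <;> linarith
    have h7 : (1 - r) * (1 - q) ≤ 1 - r := by nlinarith
    have h8 : η * c ^ 2 ≤ 4 * ((2 - r - q) ^ 2 - d ^ 2) := by
      nlinarith [mul_nonneg (sub_nonneg.2 hη1.le) (sub_nonneg.2 (h2.trans h1)),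
        mul_nonneg (mul_nonneg hη0.le (sub_nonneg.2 hη1.le)) (sq_nonneg d)]
    nlinarith

theorem stmt7 (c η : ℝ) (hc : 0 < c) (hη0 : 0 < η) (hη1 : η < 1) :
    ∃ ε : ℝ, 0 < ε ∧
      ∀ (a b : EuclideanSpace ℝ (Fin 2)) (s u : ℝ),
        jmNorm (a, s) = 1 → jmNorm (b, u) = 1 →
        c ≤ Real.sqrt (‖a - b‖ ^ 2 + (s - u) ^ 2) →
        (|s - u| ≤ (1 - η) * ‖a - b‖ ∨ (1 + η) * ‖a - b‖ ≤ |s - u|) →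
        jmNorm ((2⁻¹ : ℝ) • ((a, s) + (b, u))) ≤ 1 - ε := by
  refine ⟨η * c ^ 2 / 16, by positivity, fun a b s u ha hb hcd h => ?_⟩
  have key : ‖a + b‖ + |s + u| ≤ 2 - η * c ^ 2 / 8 := by
    simp only [jmNorm] at ha hb
    have hcd' : c ^ 2 ≤ ‖a - b‖ ^ 2 + |s - u| ^ 2 := by
      rw [sq_abs]
      exact (Real.le_sqrt' hc).1 hcd
    have hpar : ‖a + b‖ ^ 2 + ‖a - b‖ ^ 2 = 2 * ‖a‖ ^ 2 + 2 * ‖b‖ ^ 2 := by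
      have := parallelogram_law_with_norm ℝ a b
      linarith
    have hpar' : ‖a + b‖ ^ 2 + ‖a - b‖ ^ 2 = 2 * ‖b‖ ^ 2 + 2 * ‖a‖ ^ 2 := by
      linarith
    have hm := norm_add_le a b
    have hd := norm_nonneg (a - b)
    have hrq := abs_norm_sub_norm_le a b
    have hr1 : ‖a‖ ≤ 1 := by linarith [abs_nonneg s]
    have hq1 : ‖b‖ ≤ 1 := by linarith [abs_nonneg u]
    have opposite (hD : |s - u| = 2 - ‖a‖ - ‖b‖) (hS : |s + u| = |‖a‖ - ‖b‖|) :
        ‖a + b‖ + |s + u| ≤ 2 - η * c ^ 2 / 8 := by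
      rw [hD] at hcd' h
      rw [hS]
      have hD' : 2 - ‖a‖ - ‖b‖ = 2 - ‖b‖ - ‖a‖ := by ring
      rcases le_total ‖b‖ ‖a‖ with hab | hab
      · rw [abs_of_nonneg (sub_nonneg.2 hab)] at hrq ⊢
        exact add_le_of_opposite_sign hη0 hη1 hr1 (norm_nonneg b) hab hd hm hpar hrq hcd' h
      · rw [abs_sub_comm, abs_of_nonneg (sub_nonneg.2 hab)] at hrq ⊢
        rw [hD'] at hcd' h
        exact add_le_of_opposite_sign hη0 hη1 hq1 (norm_nonneg a) hab hd (by linarith) hpar'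
          hrq hcd' h
    have same (hD : |s - u| = |‖a‖ - ‖b‖|) (hS : |s + u| = 2 - ‖a‖ - ‖b‖) :
        ‖a + b‖ + |s + u| ≤ 2 - η * c ^ 2 / 8 := by
      rw [hD] at hcd' h
      rw [hS]
      exact add_le_of_same_sign hc hη0 hη1 hr1 hq1 hd hrq hm hpar hcd' h
    rcases le_total 0 s with hs | hs <;> rcases le_total 0 u with hu | hu <;>
      simp only [abs_of_nonneg, abs_of_nonpos, hs, hu] at ha hb
    · apply same <;> grind
    · apply opposite <;> grind
    · apply opposite <;> grind
    · apply same <;> grind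
  have h2 : jmNorm ((2⁻¹ : ℝ) • ((a, s) + (b, u))) = 2⁻¹ * (‖a + b‖ + |s + u|) := by
    simp only [jmNorm, Prod.mk_add_mk, Prod.smul_mk, norm_smul, smul_eq_mul, abs_mul]
    norm_num
    ring
  rw [h2]
  linarith
end

section
/- For any norm N on ℝ³, the set of directions of line segments lying in the unit sphere of N has measure zero: the set {u : u ∈ ℝ³, ‖u‖₂ = 1, and there exist A ≠ B with N(A) = N(B) = N of every point of the segment [A,B] equal to 1 and B − A parallel to u} is a subset of the Euclidean unit sphere of two-dimensional Hausdorff measure zero. -/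
open MeasureTheory

/-- The points of a planar set `S` at which the functional `x ↦ t * x.1 + x.2` is maximal. -/
def slopeFace (S : Set (ℝ × ℝ)) (t : ℝ) : Set (ℝ × ℝ) :=
  {a ∈ S | ∀ x ∈ S, t * x.1 + x.2 ≤ t * a.1 + a.2}

lemma slopeFace_fst_le {S : Set (ℝ × ℝ)} {t t' : ℝ} {a a' : ℝ × ℝ} (ha : a ∈ slopeFace S t)
    (ha' : a' ∈ slopeFace S t') (h : t < t') : a.1 ≤ a'.1 := by
  have h1 := ha.2 a' ha'.1
  have h2 := ha'.2 a ha.1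
  nlinarith

lemma dist_le_of_mem_slopeFace {S : Set (ℝ × ℝ)} {t t' : ℝ} {a a' : ℝ × ℝ} (ht : |t| ≤ 1)
    (ht' : |t'| ≤ 1) (ha : a ∈ slopeFace S t) (ha' : a' ∈ slopeFace S t') :
    dist a a' ≤ |a.1 - a'.1| := by
  have h1 := ha.2 a' ha'.1
  have h2 := ha'.2 a ha.1
  have bound : ∀ s : ℝ, |s| ≤ 1 → |s * (a.1 - a'.1)| ≤ |a.1 - a'.1| := fun s hs => by
    rw [abs_mul]
    exact mul_le_of_le_one_left (abs_nonneg _) hs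
  have h3 := abs_le.1 (bound t ht)
  have h4 := abs_le.1 (bound t' ht')
  rw [Prod.dist_eq, Real.dist_eq, Real.dist_eq]
  refine max_le le_rfl (abs_le.2 ⟨?_, ?_⟩) <;> linarith

/-- The differences of points of `S₀` and `S₁` maximizing a common functional
`x ↦ t * x.1 + x.2`, for some slope `|t| ≤ 1`. -/
def commonFaceDiff (S₀ S₁ : Set (ℝ × ℝ)) : Set (ℝ × ℝ) :=
  {c | ∃ t : ℝ, |t| ≤ 1 ∧ ∃ a ∈ slopeFace S₀ t, ∃ b ∈ slopeFace S₁ t, c = b - a}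

lemma dimH_slopeFace_diff_le (S₀ S₁ : Set (ℝ × ℝ)) (t : ℝ) :
    dimH {c | ∃ a ∈ slopeFace S₀ t, ∃ b ∈ slopeFace S₁ t, c = b - a} ≤ 1 := by
  rcases Set.eq_empty_or_nonempty {c | ∃ a ∈ slopeFace S₀ t, ∃ b ∈ slopeFace S₁ t, c = b - a}
    with h | ⟨c₀, a₀, ha₀, b₀, hb₀, rfl⟩
  · rw [h, dimH_empty]
    exact zero_le_one
  · set m := t * (b₀ - a₀).1 + (b₀ - a₀).2 with hm
    have hf : ContDiff ℝ 1 (fun x : ℝ => (x, m - t * x)) := by fun_prop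
    refine (dimH_mono ?_).trans (hf.dimH_range_le.trans (by simp))
    rintro _ ⟨a, ha, b, hb, rfl⟩
    refine ⟨(b - a).1, Prod.ext rfl ?_⟩
    have h1 := ha.2 a₀ ha₀.1
    have h2 := ha₀.2 a ha.1
    have h3 := hb.2 b₀ hb₀.1
    have h4 := hb₀.2 b hb.1
    simp only [Prod.fst_sub, Prod.snd_sub] at hm ⊢
    linarith

lemma countable_setOf_slopeFace_sum_nontrivial (S₀ S₁ : Set (ℝ × ℝ)) :
    {t : ℝ | ∃ a ∈ slopeFace S₀ t, ∃ b ∈ slopeFace S₁ t, ∃ a' ∈ slopeFace S₀ t,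
      ∃ b' ∈ slopeFace S₁ t, a.1 + b.1 < a'.1 + b'.1}.Countable := by
  set D := {t : ℝ | ∃ a ∈ slopeFace S₀ t, ∃ b ∈ slopeFace S₁ t, ∃ a' ∈ slopeFace S₀ t,
    ∃ b' ∈ slopeFace S₁ t, a.1 + b.1 < a'.1 + b'.1} with hD
  have hD' : ∀ t : ℝ, ∃ a b a' b' : ℝ × ℝ, t ∈ D → a ∈ slopeFace S₀ t ∧ b ∈ slopeFace S₁ t ∧
      a' ∈ slopeFace S₀ t ∧ b' ∈ slopeFace S₁ t ∧ a.1 + b.1 < a'.1 + b'.1 := by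
    intro t
    by_cases ht : t ∈ D
    · obtain ⟨a, ha, b, hb, a', ha', b', hb', h⟩ := ht
      exact ⟨a, b, a', b', fun _ => ⟨ha, hb, ha', hb', h⟩⟩
    · exact ⟨0, 0, 0, 0, fun h => absurd h ht⟩
  choose a b a' b' h using hD'
  have disj : ∀ t ∈ D, ∀ t' ∈ D, t < t' →
      Disjoint (Set.Ioo ((a t).1 + (b t).1) ((a' t).1 + (b' t).1))
        (Set.Ioo ((a t').1 + (b t').1) ((a' t').1 + (b' t').1)) := by
    intro t ht t' ht' hlt
    obtain ⟨-, -, h1, h2, -⟩ := h t ht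
    obtain ⟨h3, h4, -⟩ := h t' ht'
    rw [Set.disjoint_left]
    intro x hx hx'
    linarith [hx.2, hx'.1, slopeFace_fst_le h1 h3 hlt, slopeFace_fst_le h2 h4 hlt]
  refine Set.PairwiseDisjoint.countable_of_isOpen
    (s := fun t => Set.Ioo ((a t).1 + (b t).1) ((a' t).1 + (b' t).1)) ?_
    (fun _ _ => isOpen_Ioo) (fun t ht => Set.nonempty_Ioo.2 (h t ht).2.2.2.2)
  intro t ht t' ht' hne
  rcases lt_or_gt_of_ne hne with hlt | hlt
  · exact disj t ht t' ht' hlt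
  · exact (disj t' ht' t ht hlt).symm

lemma dimH_le_one_of_dist_le {X : Type*} [MetricSpace X] {V : Set X} (R : ℝ → X → Prop)
    (hV : ∀ c ∈ V, ∃ s, R s c) (hR : ∀ s c s' c', R s c → R s' c' → dist c c' ≤ |s - s'|) :
    dimH V ≤ 1 := by
  classical
  rcases V.eq_empty_or_nonempty with rfl | ⟨c₀, -⟩
  · simp
  let F : ℝ → X := fun s => if h : ∃ c, R s c then h.choose else c₀
  have hF : ∀ s ∈ {s | ∃ c, R s c}, R s (F s) := fun s hs => by
    simp only [F, dif_pos (show ∃ c, R s c from hs)]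
    exact Exists.choose_spec hs
  have hL : LipschitzOnWith 1 F {s | ∃ c, R s c} := by
    refine LipschitzOnWith.of_dist_le_mul fun s hs s' hs' => ?_
    simpa [Real.dist_eq] using hR _ _ _ _ (hF s hs) (hF s' hs')
  have hsub : V ⊆ F '' {s | ∃ c, R s c} := by
    intro c hc
    obtain ⟨s, hs⟩ := hV c hc
    refine ⟨s, ⟨c, hs⟩, ?_⟩
    have := hR _ _ _ _ (hF s ⟨c, hs⟩) hs
    rw [sub_self, abs_zero] at this
    exact dist_le_zero.1 this
  calc dimH V ≤ dimH (F '' {s | ∃ c, R s c}) := dimH_mono hsub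
    _ ≤ dimH {s | ∃ c, R s c} := hL.dimH_image_le
    _ ≤ dimH (Set.univ : Set ℝ) := dimH_mono (Set.subset_univ _)
    _ = 1 := Real.dimH_univ

lemma dimH_commonFaceDiff_le (S₀ S₁ : Set (ℝ × ℝ)) : dimH (commonFaceDiff S₀ S₁) ≤ 1 := by
  set D := {t : ℝ | ∃ a ∈ slopeFace S₀ t, ∃ b ∈ slopeFace S₁ t, ∃ a' ∈ slopeFace S₀ t,
    ∃ b' ∈ slopeFace S₁ t, a.1 + b.1 < a'.1 + b'.1} with hD
  have hDc : D.Countable := countable_setOf_slopeFace_sum_nontrivial S₀ S₁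
  let R : ℝ → ℝ × ℝ → Prop := fun s c => ∃ t : ℝ, |t| ≤ 1 ∧ t ∉ D ∧ ∃ a ∈ slopeFace S₀ t,
    ∃ b ∈ slopeFace S₁ t, s = a.1 + b.1 ∧ c = b - a
  have hR : ∀ s c s' c', R s c → R s' c' → dist c c' ≤ |s - s'| := by
    rintro _ _ _ _ ⟨t, ht, htD, a, ha, b, hb, rfl, rfl⟩ ⟨t', ht', -, a', ha', b', hb', rfl, rfl⟩
    have h1 := dist_le_of_mem_slopeFace ht ht' ha ha'
    have h2 := dist_le_of_mem_slopeFace ht ht' hb hb'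
    have h3 : dist (b - a) (b' - a') ≤ dist b b' + dist a a' := dist_sub_sub_le _ _ _ _
    refine h3.trans ?_
    rcases lt_trichotomy t t' with hlt | rfl | hlt
    · have h4 := slopeFace_fst_le ha ha' hlt
      have h5 := slopeFace_fst_le hb hb' hlt
      rw [abs_of_nonpos (by linarith)] at h1 h2 ⊢
      linarith
    · have key : ∀ x ∈ slopeFace S₀ t, ∀ y ∈ slopeFace S₁ t, ∀ x' ∈ slopeFace S₀ t,
          ∀ y' ∈ slopeFace S₁ t, x'.1 + y'.1 ≤ x.1 + y.1 := by
        intro x hx y hy x' hx' y' hy'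
        by_contra! hlt
        exact htD ⟨x, hx, y, hy, x', hx', y', hy', hlt⟩
      have e1 : a.1 - a'.1 = 0 := by
        linarith [key a ha b hb a' ha' b hb, key a' ha' b hb a ha b hb]
      have e2 : b.1 - b'.1 = 0 := by
        linarith [key a ha b hb a ha b' hb', key a ha b' hb' a ha b hb]
      rw [e1, abs_zero] at h1
      rw [e2, abs_zero] at h2
      linarith [abs_nonneg (a.1 + b.1 - (a'.1 + b'.1))]
    · have h4 := slopeFace_fst_le ha' ha hlt
      have h5 := slopeFace_fst_le hb' hb hlt
      rw [abs_of_nonneg (by linarith)] at h1 h2 ⊢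
      linarith
  have hsub : commonFaceDiff S₀ S₁ ⊆
      (⋃ t ∈ D, {c | ∃ a ∈ slopeFace S₀ t, ∃ b ∈ slopeFace S₁ t, c = b - a}) ∪
        {c | ∃ s, R s c} := by
    rintro c ⟨t, ht, a, ha, b, hb, hc⟩
    by_cases htD : t ∈ D
    · exact Or.inl (Set.mem_biUnion htD ⟨a, ha, b, hb, hc⟩)
    · exact Or.inr ⟨_, t, ht, htD, a, ha, b, hb, rfl, hc⟩
  refine (dimH_mono hsub).trans ?_
  rw [dimH_union, dimH_bUnion hDc]
  exact max_le (iSup₂_le fun t _ => dimH_slopeFace_diff_le S₀ S₁ t)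
    (dimH_le_one_of_dist_le R (fun _ hc => hc) hR)

/-- The unit vector in the direction with coordinates `d`, `ε * y.2`, `y.1` at the indices
`σ 0`, `σ 1`, `σ 2`. -/
noncomputable def permutedDirection (σ : Equiv.Perm (Fin 3)) (ε d : ℝ) (y : ℝ × ℝ) :
    EuclideanSpace ℝ (Fin 3) :=
  let v : EuclideanSpace ℝ (Fin 3) := d • EuclideanSpace.single (σ 0) (1 : ℝ) +
    (ε * y.2) • EuclideanSpace.single (σ 1) (1 : ℝ) + y.1 • EuclideanSpace.single (σ 2) (1 : ℝ)
  ‖v‖⁻¹ • v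

lemma contDiff_permutedDirection (σ : Equiv.Perm (Fin 3)) (ε : ℝ) {d : ℝ} (hd : d ≠ 0) :
    ContDiff ℝ 1 (permutedDirection σ ε d) := by
  have hv : ∀ y : ℝ × ℝ, d • EuclideanSpace.single (σ 0) (1 : ℝ) +
      (ε * y.2) • EuclideanSpace.single (σ 1) (1 : ℝ) +
        y.1 • EuclideanSpace.single (σ 2) (1 : ℝ) ≠ 0 := by
    intro y h
    have h0 := congrArg (fun v : EuclideanSpace ℝ (Fin 3) => v (σ 0)) h
    simp [hd] at h0
  have hc : ContDiff ℝ 1 fun y : ℝ × ℝ => d • EuclideanSpace.single (σ 0) (1 : ℝ) +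
      (ε * y.2) • EuclideanSpace.single (σ 1) (1 : ℝ) +
        y.1 • EuclideanSpace.single (σ 2) (1 : ℝ) := by fun_prop
  exact ((hc.norm ℝ hv).inv fun y => norm_ne_zero_iff.2 (hv y)).smul hc

/-- The slice of the unit sphere of `N` at height `p` in the coordinate `σ 0`, in the
coordinates `σ 2` and `ε` times `σ 1`. -/
def sphereSlice (N : EuclideanSpace ℝ (Fin 3) → ℝ) (σ : Equiv.Perm (Fin 3)) (ε p : ℝ) :
    Set (ℝ × ℝ) :=
  (fun x : EuclideanSpace ℝ (Fin 3) => (x (σ 2), ε * x (σ 1))) '' {x | N x = 1 ∧ x (σ 0) = p}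

lemma exists_linear_eq_one_of_segment {E : Type*} [AddCommGroup E] [Module ℝ E] {N : E → ℝ}
    (hN_triangle : ∀ x y, N (x + y) ≤ N x + N y) (hN_smul : ∀ (c : ℝ) (x), N (c • x) = |c| * N x)
    {A B : E} (h : ∀ p ∈ segment ℝ A B, N p = 1) :
    ∃ f : E →ₗ[ℝ] ℝ, (∀ x, f x ≤ N x) ∧ f A = 1 ∧ f B = 1 := by
  set m := midpoint ℝ A B with hm
  have hm1 : N m = 1 := h m (midpoint_mem_segment A B)
  have hm0 : m ≠ 0 := by
    intro h0
    have := hN_smul 0 m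
    rw [zero_smul, ← h0, hm1] at this
    simp at this
  obtain ⟨f, hf, hfN⟩ := exists_extension_of_le_sublinear
    (LinearPMap.mkSpanSingleton (σ := RingHom.id ℝ) m (1 : ℝ) hm0) N
    (fun c hc x => by rw [hN_smul, abs_of_pos hc]) hN_triangle (by
      rintro ⟨x, hx⟩
      obtain ⟨c, rfl⟩ := Submodule.mem_span_singleton.1 hx
      rw [LinearPMap.mkSpanSingleton'_apply]
      simpa [hN_smul, hm1] using le_abs_self c)
  have hfm : f m = 1 := by
    rw [hf ⟨m, Submodule.mem_span_singleton_self m⟩]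
    exact LinearPMap.mkSpanSingleton'_apply_self _ _ _ _
  have hsum : f A + f B = 2 := by
    have := congrArg f (midpoint_add_self ℝ A B)
    rw [map_add, map_add, ← hm, hfm] at this
    linarith
  have hA := (hfN A).trans_eq (h A (left_mem_segment ℝ A B))
  have hB := (hfN B).trans_eq (h B (right_mem_segment ℝ A B))
  exact ⟨f, hfN, by linarith, by linarith⟩

lemma exists_perm_abs_le {u g : Fin 3 → ℝ} (hu : u ≠ 0) :
    ∃ σ : Equiv.Perm (Fin 3), u (σ 0) ≠ 0 ∧ |g (σ 2)| ≤ |g (σ 1)| := by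
  obtain ⟨k, hk⟩ := Function.ne_iff.1 hu
  rcases le_total |g (Equiv.swap 0 k 2)| |g (Equiv.swap 0 k 1)| with h | h
  · exact ⟨Equiv.swap 0 k, by simpa using hk, h⟩
  · refine ⟨Equiv.swap 0 k * Equiv.swap 1 2, ?_, ?_⟩
    · have : Equiv.swap (1 : Fin 3) 2 0 = 0 := by decide
      simpa [this] using hk
    · simpa using h

lemma exists_rat_eq_add_mul (a : ℝ) {w : ℝ} (hw : w ≠ 0) :
    ∃ (p q : ℚ) (s t : ℝ), 0 ≤ s ∧ s < t ∧ t ≤ 1 ∧ a + s * w = p ∧ a + t * w = q := by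
  have key : ∀ r : ℝ, a + (r - a) / w * w = r := fun r => by
    rw [div_mul_cancel₀ _ hw]
    ring
  rcases lt_or_gt_of_ne hw with h | h
  · obtain ⟨p, hp1, hp2⟩ := exists_rat_btwn (show a + w < a by linarith)
    obtain ⟨q, hq1, hq2⟩ := exists_rat_btwn hp1
    refine ⟨p, q, (p - a) / w, (q - a) / w, ?_, ?_, ?_, key p, key q⟩
    · exact div_nonneg_of_nonpos (by linarith) h.le
    · exact (div_lt_div_right_of_neg h).2 (by linarith)
    · rw [div_le_one_of_neg h]
      linarith
  · obtain ⟨p, hp1, hp2⟩ := exists_rat_btwn (show a < a + w by linarith)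
    obtain ⟨q, hq1, hq2⟩ := exists_rat_btwn hp2
    refine ⟨p, q, (p - a) / w, (q - a) / w, ?_, ?_, ?_, key p, key q⟩
    · exact div_nonneg (by linarith) h.le
    · exact (div_lt_div_iff_of_pos_right h).2 (by linarith)
    · rw [div_le_one h]
      linarith

lemma eq_sum_perm_single (σ : Equiv.Perm (Fin 3)) (x : EuclideanSpace ℝ (Fin 3)) :
    x = x (σ 0) • EuclideanSpace.single (σ 0) (1 : ℝ) +
      x (σ 1) • EuclideanSpace.single (σ 1) (1 : ℝ) +
        x (σ 2) • EuclideanSpace.single (σ 2) (1 : ℝ) := by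
  ext n
  obtain ⟨n, rfl⟩ := σ.surjective n
  fin_cases n <;> simp

lemma mem_slopeFace_sphereSlice {N : EuclideanSpace ℝ (Fin 3) → ℝ}
    {f : EuclideanSpace ℝ (Fin 3) →ₗ[ℝ] ℝ} (hf : ∀ x, f x ≤ N x) (σ : Equiv.Perm (Fin 3))
    {ε : ℝ} (hi : 0 < |f (EuclideanSpace.single (σ 1) 1)|)
    (hε : |f (EuclideanSpace.single (σ 1) 1)| * ε = f (EuclideanSpace.single (σ 1) 1))
    {X : EuclideanSpace ℝ (Fin 3)} (hX : N X = 1) (hfX : f X = 1) :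
    (X (σ 2), ε * X (σ 1)) ∈ slopeFace (sphereSlice N σ ε (X (σ 0)))
      (f (EuclideanSpace.single (σ 2) 1) / |f (EuclideanSpace.single (σ 1) 1)|) := by
  refine ⟨⟨X, ⟨hX, rfl⟩, rfl⟩, ?_⟩
  rintro _ ⟨x, ⟨hx, hx0⟩, rfl⟩
  have h : f x ≤ f X := by
    rw [hfX, ← hx]
    exact hf x
  rw [eq_sum_perm_single σ x, eq_sum_perm_single σ X] at h
  simp only [map_add, map_smul, smul_eq_mul, hx0] at h
  have e : ∀ y z : ℝ, |f (EuclideanSpace.single (σ 1) 1)| *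
      (f (EuclideanSpace.single (σ 2) 1) / |f (EuclideanSpace.single (σ 1) 1)| * y + ε * z) =
      f (EuclideanSpace.single (σ 2) 1) * y + f (EuclideanSpace.single (σ 1) 1) * z := by
    intro y z
    rw [mul_add, ← mul_assoc, ← mul_assoc, hε, mul_div_cancel₀ _ hi.ne']
  refine le_of_mul_le_mul_left ?_ hi
  rw [e, e]
  linarith

lemma exists_mem_image_permutedDirection {N : EuclideanSpace ℝ (Fin 3) → ℝ}
    (hN_triangle : ∀ x y, N (x + y) ≤ N x + N y) (hN_smul : ∀ (c : ℝ) (x), N (c • x) = |c| * N x)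
    {u A B : EuclideanSpace ℝ (Fin 3)} (hu : ‖u‖ = 1) (h : ∀ p ∈ segment ℝ A B, N p = 1)
    {l : ℝ} (hl : 0 < l) (hAB : B - A = l • u) :
    ∃ (σ : Equiv.Perm (Fin 3)) (ε : ℤˣ) (p q : ℚ), p ≠ q ∧
      u ∈ permutedDirection σ ((ε : ℤ) : ℝ) ((q : ℝ) - p) ''
        commonFaceDiff (sphereSlice N σ ((ε : ℤ) : ℝ) p) (sphereSlice N σ ((ε : ℤ) : ℝ) q) := by
  obtain ⟨f, hfN, hfA, hfB⟩ := exists_linear_eq_one_of_segment hN_triangle hN_smul h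
  have hu0 : (fun n => u n) ≠ 0 := by
    intro h0
    have : u = 0 := by
      ext n
      exact congrFun h0 n
    simp [this] at hu
  obtain ⟨σ, hσ0, hσ⟩ := exists_perm_abs_le (g := fun n => f (EuclideanSpace.single n 1)) hu0
  obtain ⟨p, q, s, t, hs, hst, ht, hp, hq⟩ := exists_rat_eq_add_mul (A (σ 0))
    (mul_ne_zero hl.ne' hσ0)
  have hfu : f (l • u) = 0 := by rw [← hAB, map_sub, hfA, hfB, sub_self]
  have hpoint : ∀ r : ℝ, 0 ≤ r → r ≤ 1 → N (A + r • l • u) = 1 ∧ f (A + r • l • u) = 1 := by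
    intro r hr hr'
    refine ⟨h _ ?_, by rw [map_add, map_smul, hfu, hfA, smul_zero, add_zero]⟩
    rw [segment_eq_image', ← hAB]
    exact ⟨r, ⟨hr, hr'⟩, rfl⟩
  obtain ⟨hNA, hfA'⟩ := hpoint s hs (hst.le.trans ht)
  obtain ⟨hNB, hfB'⟩ := hpoint t (hs.trans hst.le) ht
  have hdiff : A + t • l • u - (A + s • l • u) = ((t - s) * l) • u := by
    rw [mul_smul, sub_smul]
    abel
  have hpos : 0 < (t - s) * l := mul_pos (sub_pos.2 hst) hl
  have hA0 : (A + s • l • u) (σ 0) = p := by simpa using hp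
  have hB0 : (A + t • l • u) (σ 0) = q := by simpa using hq
  generalize A + s • l • u = X at *
  generalize A + t • l • u = Y at *
  have hpq : (q : ℝ) - p ≠ 0 := by
    have : (Y - X) (σ 0) = (q : ℝ) - p := by rw [PiLp.sub_apply, hA0, hB0]
    rw [← this, hdiff]
    exact mul_ne_zero hpos.ne' hσ0
  have hi : 0 < |f (EuclideanSpace.single (σ 1) 1)| := by
    refine (abs_nonneg _).lt_of_ne fun h0 => ?_
    have h1 : f (EuclideanSpace.single (σ 1) 1) = 0 := abs_eq_zero.1 h0.symm
    have h2 : f (EuclideanSpace.single (σ 2) 1) = 0 :=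
      abs_eq_zero.1 (le_antisymm (hσ.trans h0.symm.le) (abs_nonneg _))
    rw [eq_sum_perm_single σ X] at hfA'
    rw [eq_sum_perm_single σ Y] at hfB'
    simp only [map_add, map_smul, smul_eq_mul, h1, h2, hA0, hB0, mul_zero, add_zero] at hfA' hfB'
    have h3 : ((q : ℝ) - p) * f (EuclideanSpace.single (σ 0) 1) = 0 := by linarith
    rw [(mul_eq_zero.1 h3).resolve_left hpq, mul_zero] at hfA'
    exact zero_ne_one hfA'
  obtain ⟨ε, hε⟩ : ∃ ε : ℤˣ, |f (EuclideanSpace.single (σ 1) 1)| * ((ε : ℤ) : ℝ) =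
      f (EuclideanSpace.single (σ 1) 1) := by
    rcases abs_choice (f (EuclideanSpace.single (σ 1) 1)) with h1 | h1
    · exact ⟨1, by simp [h1]⟩
    · exact ⟨-1, by simp [h1]⟩
  have hεε : ((ε : ℤ) : ℝ) * ((ε : ℤ) : ℝ) = 1 := by
    rcases Int.units_eq_one_or ε with rfl | rfl <;> simp
  have hX := mem_slopeFace_sphereSlice hfN σ hi hε hNA hfA'
  have hY := mem_slopeFace_sphereSlice hfN σ hi hε hNB hfB'
  rw [hA0] at hX
  rw [hB0] at hY
  refine ⟨σ, ε, p, q, fun h0 => hpq (by rw [h0, sub_self]), _,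
    ⟨_, ?_, _, hX, _, hY, rfl⟩, ?_⟩
  · rw [abs_div, abs_abs]
    exact div_le_one_of_le₀ hσ (abs_nonneg _)
  · have hv : ((q : ℝ) - p) • EuclideanSpace.single (σ 0) (1 : ℝ) +
        (((ε : ℤ) : ℝ) * (((ε : ℤ) : ℝ) * Y (σ 1) - ((ε : ℤ) : ℝ) * X (σ 1))) •
          EuclideanSpace.single (σ 1) (1 : ℝ) +
        (Y (σ 2) - X (σ 2)) • EuclideanSpace.single (σ 2) (1 : ℝ) = ((t - s) * l) • u := by
      rw [← mul_sub, ← mul_assoc, hεε, one_mul, ← hdiff, eq_sum_perm_single σ (Y - X)]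
      simp only [← hA0, ← hB0, ← PiLp.sub_apply]
    simp only [permutedDirection, Prod.fst_sub, Prod.snd_sub]
    rw [hv, norm_smul, hu, mul_one, Real.norm_of_nonneg hpos.le, inv_smul_smul₀ hpos.ne']

theorem stmt8 (N : EuclideanSpace ℝ (Fin 3) → ℝ)
    (hN_triangle : ∀ x y, N (x + y) ≤ N x + N y)
    (hN_smul : ∀ (c : ℝ) (x), N (c • x) = |c| * N x)
    (hN_zero : ∀ x, N x = 0 → x = 0) :
    μH[2] {u : EuclideanSpace ℝ (Fin 3) | ‖u‖ = 1 ∧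
      ∃ A B : EuclideanSpace ℝ (Fin 3), A ≠ B ∧
        (∀ p ∈ segment ℝ A B, N p = 1) ∧
        ∃ l : ℝ, l ≠ 0 ∧ B - A = l • u} = 0 := by
  set U := ⋃ (σ : Equiv.Perm (Fin 3)) (ε : ℤˣ) (p : ℚ) (q : ℚ) (_ : p ≠ q),
    permutedDirection σ ((ε : ℤ) : ℝ) ((q : ℝ) - p) ''
      commonFaceDiff (sphereSlice N σ ((ε : ℤ) : ℝ) p) (sphereSlice N σ ((ε : ℤ) : ℝ) q) with hU
  have hdim : dimH U ≤ 1 := by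
    simp only [hU, dimH_iUnion, iSup_le_iff]
    intro σ ε p q hpq
    have hd : (q : ℝ) - p ≠ 0 := sub_ne_zero.2 (by exact_mod_cast hpq.symm)
    exact ((contDiff_permutedDirection σ _ hd).contDiffOn.dimH_image_le convex_univ
      (Set.subset_univ _)).trans (dimH_commonFaceDiff_le _ _)
  have hU0 : μH[2] U = 0 := by
    have hlt : dimH U < ((2 : NNReal) : ENNReal) := hdim.trans_lt (by norm_num)
    exact_mod_cast hausdorffMeasure_of_dimH_lt hlt
  refine measure_mono_null ?_ hU0
  rintro u ⟨hu, A, B, -, hseg, l, hl, hAB⟩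
  simp only [hU, Set.mem_iUnion, exists_prop]
  rcases lt_or_gt_of_ne hl with hneg | hpos
  · refine exists_mem_image_permutedDirection hN_triangle hN_smul hu
      (by rwa [segment_symm]) (neg_pos.2 hneg) (A := B) (B := A) ?_
    rw [neg_smul, ← hAB, neg_sub]
  · exact exists_mem_image_permutedDirection hN_triangle hN_smul hu hseg hpos hAB
end
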